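/- arXiv:1204.1208 — 4 statements merged into one kernel-verified Lean document; each statement's English description precedes it below -/
import Mathlib

section
/- Let F be a Borel probability measure on [0,∞) whose tail function F̄(x) = F((x,∞)) is regularly varying at infinity with index −α, i.e. F̄(x) = ℓ(x)·x^{−α} for some slowly varying function ℓ, and let p be a real number with 0 ≤ p < α. Then for every constant a > 0, the ratio (∫_{(ax,∞)} r^p F(dr)) / ((α/(α−p))·a^{−(α−p)}·F̄(x)·x^p) tends to 1 as x → ∞. -/
open MeasureTheory Filter Set Metric ProbabilityTheory

noncomputable section

/-- A measurable positive function is slowly varying at infinity if `ℓ(a t)/ℓ(t) → 1`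
as `t → ∞` for every `a > 0`. -/
def SlowlyVarying (ℓ : ℝ → ℝ) : Prop :=
  Measurable ℓ ∧ (∀ x > 0, 0 < ℓ x) ∧
    ∀ a > 0, Tendsto (fun t => ℓ (a * t) / ℓ t) atTop (nhds 1)

/-- Tail function `F̄(x) = F((x,∞))` of a measure on `ℝ`. -/
def tailF (F : Measure ℝ) (x : ℝ) : ℝ := (F (Ioi x)).toReal

lemma kar_int (γ p : ℝ) (hp : 0 < p) (hγ : p < γ) :
    IntegrableOn (fun s : ℝ => (max s 1) ^ (-γ) * s ^ (p - 1)) (Ioi 0) ∧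
    ∫ s in Ioi (0:ℝ), (max s 1) ^ (-γ) * s ^ (p - 1) = 1 / p + 1 / (γ - p) := by
  have e1 : EqOn (fun s : ℝ => s ^ (p - 1)) (fun s : ℝ => (max s 1) ^ (-γ) * s ^ (p - 1))
      (Ioc 0 1) := by
    intro s hs
    simp [max_eq_right hs.2]
  have e2 : EqOn (fun s : ℝ => s ^ (-γ + (p - 1)))
      (fun s : ℝ => (max s 1) ^ (-γ) * s ^ (p - 1)) (Ioi 1) := by
    intro s hs
    have hs1 : (1:ℝ) < s := hs
    simp only [max_eq_left hs1.le]
    rw [Real.rpow_add (by linarith)]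
  have i1' : IntegrableOn (fun s : ℝ => s ^ (p - 1)) (Ioc 0 1) := by
    rw [← intervalIntegrable_iff_integrableOn_Ioc_of_le zero_le_one]
    exact intervalIntegral.intervalIntegrable_rpow' (by linarith)
  have i2' : IntegrableOn (fun s : ℝ => s ^ (-γ + (p - 1))) (Ioi 1) :=
    integrableOn_Ioi_rpow_of_lt (by linarith) one_pos
  have i1 := i1'.congr_fun e1 measurableSet_Ioc
  have i2 := i2'.congr_fun e2 measurableSet_Ioi
  have hU : Ioc (0:ℝ) 1 ∪ Ioi 1 = Ioi 0 := Ioc_union_Ioi_eq_Ioi zero_le_one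
  constructor
  · rw [← hU]; exact i1.union i2
  · rw [← hU, setIntegral_union Ioc_disjoint_Ioi_same measurableSet_Ioi i1 i2,
      ← setIntegral_congr_fun measurableSet_Ioc e1, ← setIntegral_congr_fun measurableSet_Ioi e2,
      integral_Ioi_rpow_of_lt (by linarith) one_pos,
      ← intervalIntegral.integral_of_le zero_le_one, integral_rpow (Or.inl (by linarith))]
    have h1 : -γ + (p - 1) + 1 = -(γ - p) := by ring
    have h2 : p - 1 + 1 = p := by ring
    rw [h1, h2, Real.zero_rpow hp.ne', Real.one_rpow, Real.one_rpow, neg_div_neg_eq]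
    simp

lemma tailF_anti (F : Measure ℝ) [IsProbabilityMeasure F] : Antitone (tailF F) := by
  intro x y h
  exact ENNReal.toReal_mono (measure_ne_top _ _) (measure_mono (Ioi_subset_Ioi h))

lemma kar_layer (F : Measure ℝ) [IsProbabilityMeasure F] (p y : ℝ) (hp : 0 < p) (hy : 0 < y) :
    ∫ r in Ioi y, r ^ p ∂F =
      y ^ p * (p * ∫ s in Ioi (0:ℝ), tailF F (max s 1 * y) * s ^ (p - 1)) := by
  have h1 : ∫ r in Ioi y, r ^ p ∂F = y ^ p * ∫ r in Ioi y, (r / y) ^ p ∂F := by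
    rw [← integral_const_mul]
    refine setIntegral_congr_fun measurableSet_Ioi ?_
    intro r hr
    have hr' : y < r := hr
    simp only
    rw [← Real.mul_rpow hy.le (div_nonneg (by linarith) hy.le), mul_div_cancel₀ _ hy.ne']
  rw [h1]
  congr 1
  have hmeas : Measurable (fun s : ℝ => tailF F (max s 1 * y)) :=
    (tailF_anti F).measurable.comp (by fun_prop)
  have hnn : 0 ≤ᵐ[F.restrict (Ioi y)] fun r : ℝ => r / y := by
    filter_upwards [ae_restrict_mem measurableSet_Ioi] with r hr
    have hr' : y < r := hr
    exact div_nonneg (by linarith) hy.le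
  rw [integral_eq_lintegral_of_nonneg_ae, integral_eq_lintegral_of_nonneg_ae,
    lintegral_rpow_eq_lintegral_meas_lt_mul (F.restrict (Ioi y)) hnn (by fun_prop) hp,
    ENNReal.toReal_mul, ENNReal.toReal_ofReal hp.le]
  · congr 2
    refine setLIntegral_congr_fun measurableSet_Ioi ?_
    intro s hs
    have hs' : (0:ℝ) < s := hs
    simp only
    rw [tailF, ENNReal.ofReal_mul ENNReal.toReal_nonneg, ENNReal.ofReal_toReal (measure_ne_top _ _),
      Measure.restrict_apply' measurableSet_Ioi]
    congr 2
    ext r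
    simp only [mem_inter_iff, mem_setOf_eq, mem_Ioi, lt_div_iff₀ hy]
    rw [max_mul_of_nonneg _ _ hy.le, one_mul, max_lt_iff]
  · filter_upwards [ae_restrict_mem measurableSet_Ioi] with s hs
    have hs' : (0:ℝ) < s := hs
    exact mul_nonneg ENNReal.toReal_nonneg (Real.rpow_nonneg hs'.le _)
  · exact (hmeas.mul (by fun_prop)).aestronglyMeasurable
  · filter_upwards [hnn] with r hr
    exact Real.rpow_nonneg hr _
  · exact Measurable.aestronglyMeasurable (by fun_prop)

lemma kar_potter (G : ℝ → ℝ) (hG : Antitone G) (hpos : ∀ x > 0, 0 < G x) (β Y : ℝ)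
    (hβ : 0 < β) (hY : 0 < Y) (h2 : ∀ y ≥ Y, G (2 * y) ≤ 2 ^ (-β) * G y) :
    ∀ y ≥ Y, ∀ s ≥ (1:ℝ), G (s * y) ≤ 2 ^ β * s ^ (-β) * G y := by
  intro y hy s hs
  have hy0 : 0 < y := by linarith
  have hn : ∀ n : ℕ, G (2 ^ n * y) ≤ ((2:ℝ) ^ (-β)) ^ n * G y := by
    intro n
    induction n with
    | zero => simp
    | succ k ih =>
      have h1 : (1:ℝ) ≤ 2 ^ k := one_le_pow₀ (by norm_num)
      have := h2 (2 ^ k * y) (by nlinarith)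
      calc G (2 ^ (k+1) * y) = G (2 * (2 ^ k * y)) := by ring_nf
        _ ≤ 2 ^ (-β) * G (2 ^ k * y) := this
        _ ≤ 2 ^ (-β) * (((2:ℝ) ^ (-β)) ^ k * G y) := by gcongr
        _ = _ := by ring
  obtain ⟨n, hn1, hn2⟩ := exists_nat_pow_near hs (one_lt_two)
  calc G (s * y) ≤ G (2 ^ n * y) := hG (by gcongr)
    _ ≤ ((2:ℝ) ^ (-β)) ^ n * G y := hn n
    _ ≤ _ := by
      refine mul_le_mul_of_nonneg_right ?_ (hpos y hy0).le
      have : ((2:ℝ) ^ (n+1)) ^ (-β) ≤ s ^ (-β) :=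
        Real.rpow_le_rpow_of_nonpos (by linarith) hn2.le (by linarith)
      calc ((2:ℝ) ^ (-β)) ^ n = 2 ^ β * ((2:ℝ) ^ (n+1)) ^ (-β) := by
            rw [← Real.rpow_natCast, ← Real.rpow_mul (by norm_num), ← Real.rpow_natCast,
              ← Real.rpow_mul (by norm_num), ← Real.rpow_add (by norm_num)]
            congr 1; push_cast; ring
        _ ≤ _ := by gcongr

lemma kar_main (F : Measure ℝ) [IsProbabilityMeasure F] (α p : ℝ)
    (hpos : ∀ x > 0, 0 < tailF F x)
    (hrv : ∀ c > 0, Tendsto (fun t => tailF F (c * t) / tailF F t) atTop (nhds (c ^ (-α))))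
    (hp : 0 < p) (hpα : p < α) :
    Tendsto (fun y => (∫ r in Ioi y, r ^ p ∂F) / (y ^ p * tailF F y)) atTop
      (nhds (α / (α - p))) := by
  obtain ⟨β, hβ1, hβ2⟩ := exists_between hpα
  have hβ0 : 0 < β := by linarith
  have hev : ∀ᶠ y in atTop, tailF F (2 * y) / tailF F y < 2 ^ (-β) :=
    (hrv 2 two_pos).eventually_lt_const
      (Real.rpow_lt_rpow_of_exponent_lt one_lt_two (by linarith))
  obtain ⟨Y, hY⟩ := eventually_atTop.1 hev
  have hY1 : (0:ℝ) < max Y 1 := by positivity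
  have hpot := kar_potter (tailF F) (tailF_anti F) hpos β (max Y 1) hβ0 hY1 (by
    intro y hy
    have h1 := hY y (le_trans (le_max_left _ _) hy)
    rw [div_lt_iff₀ (hpos y (by linarith))] at h1
    exact h1.le)
  have hlim : Tendsto (fun y => ∫ s in Ioi (0:ℝ),
      (tailF F (max s 1 * y) / tailF F y) * s ^ (p - 1)) atTop
      (nhds (∫ s in Ioi (0:ℝ), (max s 1) ^ (-α) * s ^ (p - 1))) := by
    refine tendsto_integral_filter_of_dominated_convergence
      (fun s => 2 ^ β * ((max s 1) ^ (-β) * s ^ (p - 1))) ?_ ?_ ?_ ?_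
    · refine Eventually.of_forall fun y => ?_
      have hmeas : Measurable (fun s : ℝ => tailF F (max s 1 * y)) :=
        (tailF_anti F).measurable.comp (by fun_prop)
      exact ((hmeas.div_const _).mul (by fun_prop)).aestronglyMeasurable
    · filter_upwards [eventually_ge_atTop (max Y 1)] with y hy
      filter_upwards [ae_restrict_mem measurableSet_Ioi] with s hs
      have hs' : (0:ℝ) < s := hs
      have hGy := hpos y (by linarith)
      have h0 : 0 ≤ tailF F (max s 1 * y) / tailF F y :=
        div_nonneg ENNReal.toReal_nonneg hGy.le
      have h3 := Real.rpow_nonneg hs'.le (p - 1)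
      rw [Real.norm_of_nonneg (mul_nonneg h0 h3), ← mul_assoc]
      refine mul_le_mul_of_nonneg_right ?_ h3
      rw [div_le_iff₀ hGy]
      exact hpot y hy _ (le_max_right _ _)
    · exact (kar_int β p hp hβ1).1.const_mul _
    · refine Eventually.of_forall fun s => ?_
      exact (hrv (max s 1) (by positivity)).mul_const _
  rw [(kar_int α p hp hpα).2] at hlim
  have hlim2 := hlim.const_mul p
  have hap : α - p ≠ 0 := by linarith
  have hc : p * (1 / p + 1 / (α - p)) = α / (α - p) := by
    have := hp.ne'
    field_simp
    ring
  rw [hc] at hlim2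
  refine hlim2.congr' ?_
  filter_upwards [eventually_gt_atTop 0] with y hy
  have hGy := (hpos y hy).ne'
  have hyp := (Real.rpow_pos_of_pos hy p).ne'
  rw [kar_layer F p y hp hy]
  have : ∀ s : ℝ, tailF F (max s 1 * y) / tailF F y * s ^ (p - 1)
      = (tailF F y)⁻¹ * (tailF F (max s 1 * y) * s ^ (p - 1)) := by
    intro s; ring
  simp only [this]
  rw [integral_const_mul]
  generalize ∫ s in Ioi (0:ℝ), tailF F (max s 1 * y) * s ^ (p - 1) = I
  field_simp

/-- Karamata-type estimate: if `F̄` is regularly varying with index `-α` and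
`0 ≤ p < α`, then `∫_{(ax,∞)} r^p F(dr) ∼ (α/(α-p)) a^{-(α-p)} F̄(x) x^p`. -/
theorem stmt0 (F : Measure ℝ) [IsProbabilityMeasure F] (hsupp : F (Iio 0) = 0)
    (α p : ℝ) (ℓ : ℝ → ℝ) (hℓ : SlowlyVarying ℓ)
    (htail : ∀ x > 0, tailF F x = ℓ x * x ^ (-α))
    (hp : 0 ≤ p) (hpα : p < α) :
    ∀ a > 0,
      Tendsto
        (fun x => (∫ r in Ioi (a * x), r ^ p ∂F) /
          ((α / (α - p)) * a ^ (-(α - p)) * tailF F x * x ^ p))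
        atTop (nhds 1) := by
  intro a ha
  have hpos : ∀ x > 0, 0 < tailF F x := by
    intro x hx
    rw [htail x hx]
    exact mul_pos (hℓ.2.1 x hx) (Real.rpow_pos_of_pos hx _)
  have hrv : ∀ c > 0,
      Tendsto (fun t => tailF F (c * t) / tailF F t) atTop (nhds (c ^ (-α))) := by
    intro c hc
    have h := (hℓ.2.2 c hc).mul_const (c ^ (-α))
    rw [one_mul] at h
    refine h.congr' ?_
    filter_upwards [eventually_gt_atTop 0] with t ht
    rw [htail _ ht, htail _ (mul_pos hc ht), Real.mul_rpow hc.le ht.le]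
    have h1 := (Real.rpow_pos_of_pos ht (-α)).ne'
    have h2 := (hℓ.2.1 t ht).ne'
    field_simp
  have hα : 0 < α := by linarith
  have hap : 0 < α - p := by linarith
  have hmain : Tendsto (fun y => (∫ r in Ioi y, r ^ p ∂F) / (y ^ p * tailF F y)) atTop
      (nhds (α / (α - p))) := by
    rcases hp.eq_or_lt with h0 | h0
    · subst h0
      have : α / (α - 0) = 1 := by rw [sub_zero]; exact div_self hα.ne'
      rw [this]
      refine tendsto_const_nhds.congr' ?_
      filter_upwards [eventually_gt_atTop 0] with y hy
      simp only [Real.rpow_zero, one_mul, setIntegral_const, smul_eq_mul, mul_one]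
      exact (div_self (hpos y hy).ne').symm
    · exact kar_main F α p hpos hrv h0 hpα
  have h1 := hmain.comp (tendsto_id.const_mul_atTop ha)
  have h2 := (h1.mul (hrv a ha)).mul_const (a ^ p / ((α / (α - p)) * a ^ (-(α - p))))
  have hA := Real.rpow_pos_of_pos ha (-(α - p))
  have hAp := Real.rpow_pos_of_pos ha p
  have hk : 0 < α / (α - p) := div_pos hα hap
  have hc : α / (α - p) * a ^ (-α) * (a ^ p / ((α / (α - p)) * a ^ (-(α - p)))) = 1 := by
    have : a ^ (-(α - p)) = a ^ (-α) * a ^ p := by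
      rw [← Real.rpow_add ha]; congr 1; ring
    have hB := Real.rpow_pos_of_pos ha (-α)
    rw [this, mul_div_assoc', mul_assoc]
    exact div_self (by positivity)
  rw [hc] at h2
  refine h2.congr' ?_
  filter_upwards [eventually_gt_atTop 0] with x hx
  have hG1 := hpos x hx
  have hG2 := hpos _ (mul_pos ha hx)
  have hxp := Real.rpow_pos_of_pos hx p
  simp only [Function.comp, id]
  rw [Real.mul_rpow ha.le hx.le]
  generalize α / (α - p) = k at *
  generalize ∫ r in Ioi (a * x), r ^ p ∂F = I
  field_simp
end
end

section
/- Let F be a Borel probability measure on [0,∞) that follows a power law with tail exponent α > d, i.e. F̄(r) = F((r,∞)) = ℓ(r)·r^{−α} with ℓ slowly varying. Then for any fixed r₁, r₂ ≥ 0, the ratio (∫_{[0,∞)} |B_{r₁+r}(0) ∩ B_{r₂+r}(z)| F(dr)) / (c_{α,d}·F̄(|z|)·|z|^d) tends to 1 as |z| → ∞, where c_{α,d} = ∫₀^∞ |B_r(0) ∩ B_r(e₁)|·α·r^{−α−1} dr and e₁ is the first standard basis vector of ℝ^d. -/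
open MeasureTheory Filter Set Metric ProbabilityTheory

noncomputable section

/-- `d`-dimensional Euclidean space. -/
abbrev Euc (d : ℕ) := EuclideanSpace ℝ (Fin d)

/-- The first standard basis vector of `ℝ^d`. -/
def e1 (d : ℕ) : Euc d := if h : 0 < d then EuclideanSpace.single (⟨0, h⟩ : Fin d) 1 else 0

/-- Volume of the closed ball of radius `r` in `ℝ^d`. -/
def ballVol (d : ℕ) (r : ℝ) : ℝ := (volume (closedBall (0 : Euc d) r)).toReal

/-- Volume of the intersection of closed balls `B_r(x)` and `B_s(y)` in `ℝ^d`. -/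
def interVol (d : ℕ) (x : Euc d) (r : ℝ) (y : Euc d) (s : ℝ) : ℝ :=
  (volume (closedBall x r ∩ closedBall y s)).toReal

/-- The constant `c_{α,d} = ∫₀^∞ |B_r(0) ∩ B_r(e₁)| α r^{-α-1} dr`. -/
def cconst (d : ℕ) (α : ℝ) : ℝ :=
  ∫ r in Ioi (0 : ℝ), interVol d 0 r (e1 d) r * (α * r ^ (-α - 1))

/-- Tonelli for a set, in `toReal` form. -/
lemma aux_swap {d : ℕ} (μ : Measure ℝ) [SFinite μ] (S : Set (ℝ × Euc d)) (hS : MeasurableSet S)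
    (h1 : ∀ r, volume {y : Euc d | (r, y) ∈ S} ≠ ⊤)
    (h2 : ∀ y : Euc d, μ {r | (r, y) ∈ S} ≠ ⊤) :
    ∫ r, (volume {y : Euc d | (r, y) ∈ S}).toReal ∂μ
      = ∫ y : Euc d, (μ {r | (r, y) ∈ S}).toReal := by
  rw [integral_toReal, integral_toReal]
  · congr 1
    have e1 := Measure.prod_apply (μ := μ) (ν := (volume : Measure (Euc d))) hS
    have e2 := Measure.prod_apply_symm (μ := μ) (ν := (volume : Measure (Euc d))) hS
    exact e1.symm.trans e2
  · exact (measurable_measure_prodMk_right hS).aemeasurable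
  · exact Eventually.of_forall fun y => (h2 y).lt_top
  · exact (measurable_measure_prodMk_left hS).aemeasurable
  · exact Eventually.of_forall fun y => (h1 y).lt_top

lemma aux_e1_norm (d : ℕ) (hd : 0 < d) : ‖e1 d‖ = 1 := by
  simp [e1, hd]

/-- The scaled maximum distance. -/
def mfun (d : ℕ) (y : Euc d) : ℝ := max ‖y‖ ‖y - e1 d‖

lemma mfun_cont (d : ℕ) : Continuous (mfun d) := by
  unfold mfun; fun_prop

lemma mfun_half (d : ℕ) (hd : 0 < d) (y : Euc d) : 1 / 2 ≤ mfun d y := by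
  have h := norm_sub_le y (y - e1 d)
  rw [sub_sub_cancel, aux_e1_norm d hd] at h
  have := le_max_left ‖y‖ ‖y - e1 d‖
  have := le_max_right ‖y‖ ‖y - e1 d‖
  unfold mfun
  linarith

lemma mfun_ge (d : ℕ) (hd : 0 < d) (y : Euc d) : (1 + ‖y‖) / 3 ≤ mfun d y := by
  have h := mfun_half d hd y
  have : ‖y‖ ≤ mfun d y := le_max_left _ _
  linarith

lemma aux_bound_integrable (d : ℕ) (hd : 0 < d) (β : ℝ) (hβ : (d : ℝ) < β) :
    Integrable (fun y : Euc d => mfun d y ^ (-β)) := by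
  have hβ0 : 0 < β := lt_of_le_of_lt (Nat.cast_nonneg d) hβ
  have h := (integrable_one_add_norm (E := Euc d) (μ := volume) (r := β)
    (by simpa using hβ)).const_mul ((1 / 3 : ℝ) ^ (-β))
  refine h.mono' ?_ (Eventually.of_forall fun y => ?_)
  · exact ((mfun_cont d).measurable.pow_const _).aestronglyMeasurable
  · have hm : 0 < mfun d y := lt_of_lt_of_le (by norm_num) (mfun_half d hd y)
    rw [Real.norm_of_nonneg (Real.rpow_nonneg hm.le _), ← Real.mul_rpow (by norm_num) (by positivity)]
    apply Real.rpow_le_rpow_of_nonpos (by positivity) _ (by linarith)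
    have := mfun_ge d hd y
    linarith

lemma aux_cconst (d : ℕ) (hd : 0 < d) (α : ℝ) (hα : 0 < α) :
    cconst d α = ∫ y : Euc d, mfun d y ^ (-α) := by
  set g : ℝ → ENNReal := fun r => ENNReal.ofReal (α * r ^ (-α - 1)) with hg
  have hgm : Measurable g := by rw [hg]; fun_prop
  set μ : Measure ℝ := (volume.restrict (Ioi (0 : ℝ))).withDensity g with hμ
  have hI : ∀ m : ℝ, 0 < m → μ (Ici m) = ENNReal.ofReal (m ^ (-α)) := by
    intro m hm
    rw [hμ, withDensity_apply _ measurableSet_Ici, Measure.restrict_restrict measurableSet_Ici,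
      inter_eq_left.mpr (Ici_subset_Ioi.mpr hm), Measure.restrict_congr_set Ioi_ae_eq_Ici.symm]
    rw [hg, ← ofReal_integral_eq_lintegral_ofReal]
    · rw [integral_const_mul, integral_Ioi_rpow_of_lt (by linarith) hm]
      congr 1
      rw [show -α - 1 + 1 = -α by ring]
      field_simp
    · exact (integrableOn_Ioi_rpow_of_lt (by linarith) hm).const_mul _
    · filter_upwards [ae_restrict_mem measurableSet_Ioi] with r hr
      have : 0 < r := hm.trans hr
      simp only [Pi.zero_apply]; positivity
  have hS : MeasurableSet {p : ℝ × Euc d | mfun d p.2 ≤ p.1} :=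
    measurableSet_le ((mfun_cont d).measurable.comp measurable_snd) measurable_fst
  have hset : ∀ r, {y : Euc d | (r, y) ∈ {p : ℝ × Euc d | mfun d p.2 ≤ p.1}}
      = closedBall 0 r ∩ closedBall (e1 d) r := by
    intro r; ext y; simp [mfun, dist_eq_norm]
  have hset2 : ∀ y, {r : ℝ | (r, y) ∈ {p : ℝ × Euc d | mfun d p.2 ≤ p.1}} = Ici (mfun d y) := by
    intro r; ext y; simp
  have hpos : ∀ y, 0 < mfun d y := fun y => lt_of_lt_of_le (by norm_num) (mfun_half d hd y)
  have key := aux_swap μ _ hS (fun r => by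
    rw [hset]
    exact ((measure_mono inter_subset_left).trans_lt measure_closedBall_lt_top).ne) (fun y => by
    rw [hset2, hI _ (hpos y)]; exact ENNReal.ofReal_ne_top)
  simp only [hset, hset2] at key
  rw [hμ, integral_withDensity_eq_integral_toReal_smul hgm
    (Eventually.of_forall fun r => ENNReal.ofReal_lt_top)] at key
  rw [← hμ] at key
  unfold cconst interVol
  convert key using 1
  · apply setIntegral_congr_fun measurableSet_Ioi
    intro r hr
    have : 0 < r := hr
    simp only [hg, smul_eq_mul]
    rw [ENNReal.toReal_ofReal (by positivity), mul_comm]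
  · congr 1; ext y
    rw [hI _ (hpos y), ENNReal.toReal_ofReal (Real.rpow_nonneg (hpos y).le _)]

lemma aux_cconst_pos (d : ℕ) (hd : 0 < d) (α : ℝ) (hα : (d : ℝ) < α) : 0 < cconst d α := by
  have hpos : ∀ y, 0 < mfun d y := fun y => lt_of_lt_of_le (by norm_num) (mfun_half d hd y)
  rw [aux_cconst d hd α (lt_of_le_of_lt (Nat.cast_nonneg d) hα)]
  rw [integral_pos_iff_support_of_nonneg (fun y => Real.rpow_nonneg (hpos y).le _)
    (aux_bound_integrable d hd α hα)]
  have : Function.support (fun y : Euc d => mfun d y ^ (-α)) = univ := by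
    ext y; simp only [Function.mem_support, mem_univ, iff_true]
    exact (Real.rpow_pos_of_pos (hpos y) _).ne'
  rw [this]
  exact Measure.measure_univ_pos.mpr (NeZero.ne _)

lemma aux_interVol_rot (d : ℕ) (hd : 0 < d) (z : Euc d) (a b : ℝ) :
    interVol d 0 a z b = interVol d 0 a (‖z‖ • e1 d) b := by
  have hn : ‖z‖ = ‖‖z‖ • e1 d‖ := by rw [norm_smul, aux_e1_norm d hd]; simp
  set w := ‖z‖ • e1 d with hw
  set L : Euc d ≃ₗᵢ[ℝ] Euc d := (Submodule.span ℝ {z - w})ᗮ.reflection with hL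
  have hLz : L z = w := Submodule.reflection_sub hn
  have hLw : L w = z := by rw [← hLz, hL]; exact Submodule.reflection_reflection _ z
  unfold interVol
  congr 1
  rw [← L.measurePreserving.measure_preimage
    ((isClosed_closedBall.inter isClosed_closedBall).measurableSet.nullMeasurableSet), preimage_inter]
  congr 2
  · ext y; simp
  · ext y
    have : dist (L y) z = dist y w := by rw [← hLw, L.dist_map]
    simp only [mem_preimage, mem_closedBall, this]

/-- Numerator formula. -/
lemma aux_num (d : ℕ) (F : Measure ℝ) [IsProbabilityMeasure F] (r₁ r₂ t : ℝ) (ht : 0 < t) :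
    ∫ r, interVol d 0 (r₁ + r) (t • e1 d) (r₂ + r) ∂F
      = t ^ d * ∫ y : Euc d, (F (Ici (t * max (‖y‖ - r₁ / t) (‖y - e1 d‖ - r₂ / t)))).toReal := by
  set M : Euc d → ℝ := fun x => max (‖x‖ - r₁) (‖x - t • e1 d‖ - r₂) with hM
  have hMc : Continuous M := by rw [hM]; fun_prop
  have hS : MeasurableSet {p : ℝ × Euc d | M p.2 ≤ p.1} :=
    measurableSet_le (hMc.measurable.comp measurable_snd) measurable_fst
  have hset : ∀ r, {y : Euc d | (r, y) ∈ {p : ℝ × Euc d | M p.2 ≤ p.1}}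
      = closedBall 0 (r₁ + r) ∩ closedBall (t • e1 d) (r₂ + r) := by
    intro r; ext y; simp [M, dist_eq_norm, add_comm]
  have hset2 : ∀ y, {r : ℝ | (r, y) ∈ {p : ℝ × Euc d | M p.2 ≤ p.1}} = Ici (M y) := by
    intro r; ext y; simp
  have key := aux_swap F _ hS (fun r => by
    rw [hset]
    exact ((measure_mono inter_subset_left).trans_lt measure_closedBall_lt_top).ne) (fun y =>
    measure_ne_top _ _)
  simp only [hset, hset2] at key
  unfold interVol
  rw [key]
  have hs := Measure.integral_comp_smul (volume : Measure (Euc d))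
    (fun x => (F (Ici (M x))).toReal) t
  have hMt : ∀ y : Euc d, M (t • y) = t * max (‖y‖ - r₁ / t) (‖y - e1 d‖ - r₂ / t) := by
    intro y
    rw [mul_max_of_nonneg _ _ ht.le, hM]
    simp only [← smul_sub, norm_smul, Real.norm_of_nonneg ht.le, mul_sub]
    congr 2 <;> field_simp
  simp only [hMt] at hs
  rw [hs]
  simp only [finrank_euclideanSpace, Fintype.card_fin, smul_eq_mul]
  rw [abs_of_pos (by positivity), mul_inv_cancel_left₀ (by positivity)]

section tail
variable (F : Measure ℝ) [IsProbabilityMeasure F]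

lemma tailF_anti_s4 {x y : ℝ} (h : x ≤ y) : tailF F y ≤ tailF F x :=
  ENNReal.toReal_mono (measure_ne_top _ _) (measure_mono (Ioi_subset_Ioi h))

lemma aux_ratio {α : ℝ} {ℓ : ℝ → ℝ} (hℓ : SlowlyVarying ℓ)
    (htail : ∀ x > 0, tailF F x = ℓ x * x ^ (-α)) (a : ℝ) (ha : 0 < a) :
    Tendsto (fun t => tailF F (a * t) / tailF F t) atTop (nhds (a ^ (-α))) := by
  have h := (hℓ.2.2 a ha).mul_const (a ^ (-α))
  rw [one_mul] at h
  refine h.congr' ?_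
  filter_upwards [eventually_gt_atTop 0] with t ht
  rw [htail _ (mul_pos ha ht), htail _ ht, Real.mul_rpow ha.le ht.le]
  have := hℓ.2.1 t ht
  have : 0 < t ^ (-α) := Real.rpow_pos_of_pos ht _
  field_simp

lemma tailF_pos {α : ℝ} {ℓ : ℝ → ℝ} (hℓ : SlowlyVarying ℓ)
    (htail : ∀ x > 0, tailF F x = ℓ x * x ^ (-α)) (t : ℝ) (ht : 0 < t) : 0 < tailF F t := by
  rw [htail t ht]; exact mul_pos (hℓ.2.1 t ht) (Real.rpow_pos_of_pos ht _)

lemma aux_ptwise {α : ℝ} {ℓ : ℝ → ℝ} (hℓ : SlowlyVarying ℓ)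
    (htail : ∀ x > 0, tailF F x = ℓ x * x ^ (-α)) (u : ℝ → ℝ) (v : ℝ) (hv : 0 < v)
    (hu : Tendsto u atTop (nhds v)) :
    Tendsto (fun t => (F (Ici (t * u t))).toReal / tailF F t) atTop (nhds (v ^ (-α))) := by
  have hcont : Tendsto (fun x : ℝ => x ^ (-α)) (nhds v) (nhds (v ^ (-α))) :=
    (Real.continuousAt_rpow_const v (-α) (Or.inl hv.ne'))
  rw [tendsto_order]
  constructor
  · intro b hb
    have h1 : ∀ᶠ x in nhdsWithin v (Ioi v), b < x ^ (-α) ∧ v < x :=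
      (((hcont.mono_left nhdsWithin_le_nhds).eventually_const_lt hb)).and self_mem_nhdsWithin
    obtain ⟨a, hab, hva⟩ := h1.exists
    filter_upwards [(aux_ratio F hℓ htail a (hv.trans hva)).eventually_const_lt hab,
      hu.eventually_lt_const hva, eventually_gt_atTop 0] with t h1 h2 h3
    refine h1.trans_le (div_le_div_of_nonneg_right ?_ (tailF_pos F hℓ htail t h3).le)
    refine ENNReal.toReal_mono (measure_ne_top _ _) (measure_mono fun x hx => ?_)
    have hx' : a * t < x := hx
    show t * u t ≤ x
    nlinarith
  · intro b hb
    have h1 : ∀ᶠ x in nhdsWithin v (Iio v), (x ^ (-α) < b ∧ 0 < x) ∧ x < v :=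
      (((hcont.mono_left nhdsWithin_le_nhds).eventually_lt_const hb).and
        (nhdsWithin_le_nhds (lt_mem_nhds hv))).and self_mem_nhdsWithin
    obtain ⟨a, ⟨hab, ha0⟩, hva⟩ := h1.exists
    filter_upwards [(aux_ratio F hℓ htail a ha0).eventually_lt_const hab,
      hu.eventually_const_lt hva, eventually_gt_atTop 0] with t h1 h2 h3
    refine lt_of_le_of_lt (div_le_div_of_nonneg_right ?_ (tailF_pos F hℓ htail t h3).le) h1
    refine ENNReal.toReal_mono (measure_ne_top _ _) (measure_mono fun x hx => ?_)
    have hx' : t * u t ≤ x := hx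
    show a * t < x
    nlinarith

/-- Potter-type bound. -/
lemma aux_potter {α : ℝ} {ℓ : ℝ → ℝ} (hℓ : SlowlyVarying ℓ)
    (htail : ∀ x > 0, tailF F x = ℓ x * x ^ (-α)) (β : ℝ) (hβ0 : 0 < β) (hβ : β < α) :
    ∃ T > 0, ∀ t ≥ T, ∀ u ≥ 1, tailF F (u * t) ≤ 2 ^ β * u ^ (-β) * tailF F t := by
  have h2 : (2 : ℝ) ^ (-α) < 2 ^ (-β) := Real.rpow_lt_rpow_of_exponent_lt (by norm_num) (by linarith)
  have hev := (aux_ratio F hℓ htail 2 (by norm_num)).eventually_lt_const h2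
  obtain ⟨T, hT⟩ := eventually_atTop.mp hev
  refine ⟨max T 1, by positivity, fun t ht u hu => ?_⟩
  have ht1 : 1 ≤ t := (le_max_right _ _).trans ht
  have htT : T ≤ t := (le_max_left _ _).trans ht
  have iter : ∀ n : ℕ, tailF F (2 ^ n * t) ≤ ((2 : ℝ) ^ (-β)) ^ n * tailF F t := by
    intro n
    induction n with
    | zero => simp
    | succ n ih =>
      have hp : (1 : ℝ) ≤ 2 ^ n := one_le_pow₀ (by norm_num)
      have hle : t ≤ 2 ^ n * t := by nlinarith
      have h := hT (2 ^ n * t) (htT.trans hle)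
      rw [div_lt_iff₀ (tailF_pos F hℓ htail _ (by positivity))] at h
      rw [pow_succ', mul_assoc, pow_succ', mul_assoc]
      exact h.le.trans (mul_le_mul_of_nonneg_left ih (by positivity))
  obtain ⟨n, hn1, hn2⟩ := exists_nat_pow_near hu (by norm_num : (1 : ℝ) < 2)
  calc tailF F (u * t) ≤ tailF F (2 ^ n * t) := tailF_anti_s4 F (by nlinarith)
    _ ≤ ((2 : ℝ) ^ (-β)) ^ n * tailF F t := iter n
    _ ≤ 2 ^ β * u ^ (-β) * tailF F t := by
      refine mul_le_mul_of_nonneg_right ?_ ENNReal.toReal_nonneg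
      have h3 : ((2 : ℝ) ^ (n + 1)) ^ (-β) ≤ u ^ (-β) :=
        Real.rpow_le_rpow_of_nonpos (by linarith) hn2.le (by linarith)
      have h4 : ((2 : ℝ) ^ (-β)) ^ n = 2 ^ β * ((2 : ℝ) ^ (n + 1)) ^ (-β) := by
        rw [pow_succ, Real.mul_rpow (by positivity) (by norm_num), ← Real.rpow_natCast,
          ← Real.rpow_natCast, ← Real.rpow_mul (by norm_num), ← Real.rpow_mul (by norm_num),
          ← Real.rpow_add (by norm_num), ← Real.rpow_add (by norm_num)]
        congr 1; ring
      rw [h4]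
      exact mul_le_mul_of_nonneg_left h3 (by positivity)

lemma aux_potter' {α : ℝ} {ℓ : ℝ → ℝ} (hℓ : SlowlyVarying ℓ)
    (htail : ∀ x > 0, tailF F x = ℓ x * x ^ (-α)) (β : ℝ) (hβ0 : 0 < β) (hβ : β < α) :
    ∃ C : ℝ, ∀ᶠ t in atTop, ∀ m ≥ (1 / 2 : ℝ), tailF F (m / 4 * t) ≤ C * m ^ (-β) * tailF F t := by
  obtain ⟨T, hT0, hT⟩ := aux_potter F hℓ htail β hβ0 hβ
  refine ⟨2 ^ β * 2 ^ (-β) * ((1 / 8) ^ (-α) + 1), ?_⟩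
  filter_upwards [eventually_ge_atTop (8 * T), (aux_ratio F hℓ htail (1 / 8) (by norm_num)).eventually_lt_const
    (lt_add_one _)] with t ht h m hm
  have ht0 : 0 < t := by linarith
  rw [div_lt_iff₀ (tailF_pos F hℓ htail t ht0)] at h
  have h1 := hT (1 / 8 * t) (by linarith) (2 * m) (by linarith)
  rw [Real.mul_rpow (by norm_num) (by linarith), show 2 * m * (1 / 8 * t) = m / 4 * t by ring] at h1
  have hm0 : 0 < m := by linarith
  calc _ ≤ _ := h1
    _ ≤ 2 ^ β * (2 ^ (-β) * m ^ (-β)) * (((1 / 8) ^ (-α) + 1) * tailF F t) :=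
      mul_le_mul_of_nonneg_left h.le (by positivity)
    _ = _ := by ring

end tail

lemma aux_main (d : ℕ) (hd : 0 < d) (F : Measure ℝ) [IsProbabilityMeasure F]
    (α : ℝ) (hα : (d : ℝ) < α)
    (ℓ : ℝ → ℝ) (hℓ : SlowlyVarying ℓ)
    (htail : ∀ x > 0, tailF F x = ℓ x * x ^ (-α))
    (r₁ r₂ : ℝ) :
    Tendsto (fun t : ℝ => ∫ y : Euc d,
      (F (Ici (t * max (‖y‖ - r₁ / t) (‖y - e1 d‖ - r₂ / t)))).toReal / tailF F t)
      atTop (nhds (cconst d α)) := by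
  have hd0 : (0 : ℝ) < d := Nat.cast_pos.mpr hd
  rw [aux_cconst d hd α (hd0.trans hα)]
  obtain ⟨β, hβ1, hβ2⟩ := exists_between hα
  obtain ⟨C, hC⟩ := aux_potter' F hℓ htail β (hd0.trans hβ1) hβ2
  refine tendsto_integral_filter_of_dominated_convergence (fun y => C * mfun d y ^ (-β)) ?_ ?_
    ((aux_bound_integrable d hd β hβ1).const_mul C) ?_
  · refine Eventually.of_forall fun t => Measurable.aestronglyMeasurable ?_
    have hanti : Antitone (fun x => F (Ici x)) := fun x y h => measure_mono (Ici_subset_Ici.mpr h)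
    have hc : Continuous fun y : Euc d => t * max (‖y‖ - r₁ / t) (‖y - e1 d‖ - r₂ / t) := by fun_prop
    exact ((hanti.measurable.comp hc.measurable).ennreal_toReal).div_const _
  · filter_upwards [hC, eventually_gt_atTop 0, eventually_ge_atTop (4 * |r₁|),
      eventually_ge_atTop (4 * |r₂|)] with t h h0 h1 h2
    refine Eventually.of_forall fun y => ?_
    have hm := mfun_half d hd y
    have e1' : r₁ / t ≤ 1 / 4 := by rw [div_le_iff₀ h0]; linarith [le_abs_self r₁]
    have e2' : r₂ / t ≤ 1 / 4 := by rw [div_le_iff₀ h0]; linarith [le_abs_self r₂]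
    have hmm : mfun d y / 4 < max (‖y‖ - r₁ / t) (‖y - e1 d‖ - r₂ / t) := by
      rcases max_choice ‖y‖ ‖y - e1 d‖ with hc | hc
      · refine lt_of_lt_of_le ?_ (le_max_left _ _)
        have : mfun d y = ‖y‖ := hc
        linarith
      · refine lt_of_lt_of_le ?_ (le_max_right _ _)
        have : mfun d y = ‖y - e1 d‖ := hc
        linarith
    rw [Real.norm_of_nonneg (div_nonneg ENNReal.toReal_nonneg (tailF_pos F hℓ htail t h0).le),
      div_le_iff₀ (tailF_pos F hℓ htail t h0)]
    refine le_trans ?_ (h _ hm)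
    refine ENNReal.toReal_mono (measure_ne_top _ _) (measure_mono fun x hx => ?_)
    have hx' : _ ≤ x := hx
    show _ < x
    refine lt_of_lt_of_le ?_ hx'
    rw [mul_comm]
    exact mul_lt_mul_of_pos_left hmm h0
  · refine Eventually.of_forall fun y => ?_
    refine aux_ptwise F hℓ htail _ (mfun d y) (lt_of_lt_of_le (by norm_num) (mfun_half d hd y)) ?_
    have l : ∀ a b : ℝ, Tendsto (fun t : ℝ => a - b / t) atTop (nhds a) := fun a b => by
      simpa using (tendsto_const_nhds (x := a)).sub (tendsto_const_nhds (x := b).div_atTop tendsto_id)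
    exact (l _ _).max (l _ _)

/-- Average intersection volume of distant balls:
`∫ |B_{r₁+r}(0) ∩ B_{r₂+r}(z)| F(dr) ∼ c_{α,d} F̄(|z|) |z|^d` as `|z| → ∞`. -/
theorem stmt4 (d : ℕ) (hd : 0 < d) (F : Measure ℝ) [IsProbabilityMeasure F]
    (hsupp : F (Iio 0) = 0) (α : ℝ) (hα : (d : ℝ) < α)
    (ℓ : ℝ → ℝ) (hℓ : SlowlyVarying ℓ)
    (htail : ∀ x > 0, tailF F x = ℓ x * x ^ (-α))
    (r₁ r₂ : ℝ) (hr₁ : 0 ≤ r₁) (hr₂ : 0 ≤ r₂) :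
    Tendsto
      (fun z : Euc d =>
        (∫ r, interVol d 0 (r₁ + r) z (r₂ + r) ∂F) /
          (cconst d α * tailF F ‖z‖ * ‖z‖ ^ d))
      (comap norm atTop) (nhds 1) := by
  have hc := aux_cconst_pos d hd α hα
  have h := (aux_main d hd F α hα ℓ hℓ htail r₁ r₂).div_const (cconst d α)
  rw [div_self hc.ne'] at h
  refine (h.comp tendsto_comap).congr' ?_
  have hev : ∀ᶠ z : Euc d in comap norm atTop, 0 < ‖z‖ :=
    tendsto_comap.eventually (eventually_gt_atTop (0 : ℝ))
  filter_upwards [hev] with z hz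
  simp only [Function.comp]
  simp_rw [aux_interVol_rot d hd z]
  rw [aux_num d F r₁ r₂ ‖z‖ hz, integral_div]
  have := tailF_pos F hℓ htail _ hz
  field_simp
end
end

section
/- Let F be a Borel probability measure on [0,∞) that follows a power law with tail exponent α > d, and let h : [0,∞) → [0,∞) be any measurable function. Then there exist constants u > 0 and c > 0 such that for all z ∈ ℝ^d with |z| > u, ∫_{[0,∞)} |B_r(0) ∩ B_r(z)| h(r) F(dr) ≤ c·(sup_{r ≥ |z|/2} h(r))·F̄(|z|)·|z|^d, where the supremum is taken in [0,∞] and the inequality is read in the extended reals. -/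
open MeasureTheory Filter Set Metric ProbabilityTheory

noncomputable section

lemma slow_ratio (α : ℝ) (F : Measure ℝ)
    (ℓ : ℝ → ℝ) (hℓ : SlowlyVarying ℓ)
    (htail : ∀ x > 0, tailF F x = ℓ x * x ^ (-α)) (a : ℝ) (ha : 0 < a) (q : ℝ)
    (hq : a ^ (-α) < q) :
    ∀ᶠ x in atTop, tailF F (a * x) ≤ q * tailF F x := by
  obtain ⟨_, hpos, hlim⟩ := hℓ
  have h1 : Tendsto (fun t => ℓ (a * t) / ℓ t * a ^ (-α)) atTop (nhds (1 * a ^ (-α))) :=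
    (hlim a ha).mul_const _
  rw [one_mul] at h1
  filter_upwards [h1.eventually (gt_mem_nhds hq), eventually_gt_atTop 0] with x hx hx0
  rw [htail x hx0, htail (a * x) (by positivity), Real.mul_rpow ha.le hx0.le]
  have h2 := hpos x hx0
  have h3 : 0 < x ^ (-α) := Real.rpow_pos_of_pos hx0 _
  have h4 : ℓ (a * x) * a ^ (-α) ≤ q * ℓ x := by
    have : ℓ (a * x) * a ^ (-α) = (ℓ (a * x) / ℓ x * a ^ (-α)) * ℓ x := by
      field_simp
    rw [this]
    exact mul_le_mul_of_nonneg_right hx.le h2.le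
  calc ℓ (a * x) * (a ^ (-α) * x ^ (-α)) = (ℓ (a * x) * a ^ (-α)) * x ^ (-α) := by ring
    _ ≤ (q * ℓ x) * x ^ (-α) := mul_le_mul_of_nonneg_right h4 h3.le
    _ = _ := by ring

lemma tail_bound (d : ℕ) (F : Measure ℝ) (α : ℝ) (hα : (d : ℝ) < α)
    (ℓ : ℝ → ℝ) (hℓ : SlowlyVarying ℓ)
    (htail : ∀ x > 0, tailF F x = ℓ x * x ^ (-α)) :
    ∃ u > 0, ∃ C > 0, ∃ q > 0, 2 ^ d * q < 1 ∧ ∀ R, u < R → ∀ k : ℕ,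
      tailF F (R / 4 * 2 ^ k) ≤ C * q ^ k * tailF F R := by
  have hlt : (2 : ℝ) ^ (-α) < (2 : ℝ) ^ (-(d : ℝ)) :=
    Real.rpow_lt_rpow_of_exponent_lt (by norm_num) (by linarith)
  obtain ⟨q, hq1, hq2⟩ := exists_between hlt
  have hq0 : 0 < q := lt_trans (by positivity) hq1
  have e1 := slow_ratio α F ℓ hℓ htail 2 (by norm_num) q hq1
  have hC0 : (0 : ℝ) < (1 / 4 : ℝ) ^ (-α) := by positivity
  have e2 := slow_ratio α F ℓ hℓ htail (1 / 4) (by norm_num) ((1 / 4 : ℝ) ^ (-α) + 1) (by linarith)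
  obtain ⟨A, hA⟩ := eventually_atTop.1 e1
  obtain ⟨B, hB⟩ := eventually_atTop.1 e2
  refine ⟨max 1 (max (4 * A) B), by positivity, (1 / 4 : ℝ) ^ (-α) + 1, by positivity, q, hq0, ?_, ?_⟩
  · rw [Real.rpow_neg (by norm_num), Real.rpow_natCast] at hq2
    calc (2 : ℝ) ^ d * q < 2 ^ d * (2 ^ d)⁻¹ := by gcongr
      _ = 1 := by field_simp
  · intro R hR k
    simp only [max_lt_iff] at hR
    obtain ⟨h1, h2, h3⟩ := hR
    induction k with
    | zero =>
      have := hB R h3.le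
      simpa [div_eq_inv_mul] using this
    | succ k ih =>
      have hk : (1 : ℝ) ≤ 2 ^ k := one_le_pow₀ (by norm_num)
      have := hA (R / 4 * 2 ^ k) (by nlinarith)
      calc tailF F (R / 4 * 2 ^ (k + 1)) = tailF F (2 * (R / 4 * 2 ^ k)) := by
            congr 1; ring
        _ ≤ q * tailF F (R / 4 * 2 ^ k) := this
        _ ≤ q * (((1 / 4 : ℝ) ^ (-α) + 1) * q ^ k * tailF F R) := by gcongr
        _ = _ := by ring

lemma vol_bound (d : ℕ) (z : Euc d) (hz : 0 < ‖z‖) (r : ℝ) :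
    volume (closedBall (0 : Euc d) r ∩ closedBall z r) ≤
      ∑' k : ℕ, volume (ball (0 : Euc d) 1) * ENNReal.ofReal ((2 ^ k * ‖z‖) ^ d) *
        (Ioi (‖z‖ / 4 * 2 ^ k)).indicator (fun _ => 1) r := by
  by_cases hr : r < ‖z‖ / 2
  · have : closedBall (0 : Euc d) r ∩ closedBall z r = ∅ := by
      rw [← Set.disjoint_iff_inter_eq_empty]
      apply closedBall_disjoint_closedBall
      rw [dist_zero_left]; linarith
    rw [this]; simp
  · push Not at hr
    obtain ⟨k, hk1, hk2⟩ := exists_nat_pow_near (x := r / (‖z‖ / 2)) (y := (2 : ℝ))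
      (by rw [le_div_iff₀ (by positivity)]; linarith) (by norm_num)
    rw [le_div_iff₀ (by positivity)] at hk1
    rw [div_lt_iff₀ (by positivity)] at hk2
    have hp : (0 : ℝ) < 2 ^ k := by positivity
    refine le_trans ?_ (ENNReal.le_tsum k)
    have hmem : r ∈ Ioi (‖z‖ / 4 * 2 ^ k) := by
      rw [mem_Ioi]; nlinarith [mul_pos hp hz]
    rw [indicator_of_mem hmem, mul_one]
    refine (measure_mono inter_subset_left).trans ?_
    have hr0 : 0 ≤ r := by linarith
    rw [Measure.addHaar_closedBall _ _ hr0, finrank_euclideanSpace_fin, mul_comm]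
    gcongr
    rw [pow_succ] at hk2
    linarith

/-- Bound for `∫ |B_r(0) ∩ B_r(z)| h(r) F(dr)` in terms of `sup_{r ≥ |z|/2} h(r)`,
in the extended reals. -/
theorem stmt6 (d : ℕ) (hd : 0 < d) (F : Measure ℝ) [IsProbabilityMeasure F]
    (hsupp : F (Iio 0) = 0) (α : ℝ) (hα : (d : ℝ) < α)
    (ℓ : ℝ → ℝ) (hℓ : SlowlyVarying ℓ)
    (htail : ∀ x > 0, tailF F x = ℓ x * x ^ (-α))
    (h : ℝ → ℝ) (hm : Measurable h) (hnn : ∀ r, 0 ≤ h r) :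
    ∃ u > 0, ∃ c > 0, ∀ z : Euc d, u < ‖z‖ →
      (∫⁻ r, volume (closedBall (0 : Euc d) r ∩ closedBall z r) *
          ENNReal.ofReal (h r) ∂F) ≤
        ENNReal.ofReal (c * tailF F ‖z‖ * ‖z‖ ^ d) *
          ⨆ r ∈ Ici (‖z‖ / 2), ENNReal.ofReal (h r) := by
  obtain ⟨u, hu, C, hC, q, hq, hq1, hb⟩ := tail_bound d F α hα ℓ hℓ htail
  set κ : ℝ := (volume (ball (0 : Euc d) 1)).toReal with hκ
  have hκ0 : 0 < κ := ENNReal.toReal_pos (measure_ball_pos _ _ one_pos).ne' measure_ball_lt_top.ne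
  have hκe : volume (ball (0 : Euc d) 1) = ENNReal.ofReal κ :=
    (ENNReal.ofReal_toReal measure_ball_lt_top.ne).symm
  have hs : 0 < 1 - 2 ^ d * q := by linarith
  refine ⟨u, hu, κ * C * (1 - 2 ^ d * q)⁻¹, by positivity, fun z hz => ?_⟩
  have hz0 : 0 < ‖z‖ := hu.trans hz
  set S := ⨆ r ∈ Ici (‖z‖ / 2), ENNReal.ofReal (h r) with hS
  have hT : 0 ≤ tailF F ‖z‖ := ENNReal.toReal_nonneg
  have hind : ∀ k : ℕ, Measurable ((Ioi (‖z‖ / 4 * 2 ^ k)).indicator (fun _ : ℝ => (1 : ENNReal))) :=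
    fun k => measurable_const.indicator measurableSet_Ioi
  have hpt : ∀ r, volume (closedBall (0 : Euc d) r ∩ closedBall z r) * ENNReal.ofReal (h r) ≤
      (∑' k : ℕ, volume (ball (0 : Euc d) 1) * ENNReal.ofReal ((2 ^ k * ‖z‖) ^ d) *
        (Ioi (‖z‖ / 4 * 2 ^ k)).indicator (fun _ => 1) r) * S := by
    intro r
    by_cases hr : r < ‖z‖ / 2
    · have : closedBall (0 : Euc d) r ∩ closedBall z r = ∅ := by
        rw [← Set.disjoint_iff_inter_eq_empty]
        apply closedBall_disjoint_closedBall
        rw [dist_zero_left]; linarith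
      rw [this]; simp
    · push Not at hr
      exact mul_le_mul' (vol_bound d z hz0 r)
        (le_iSup₂ (f := fun (r : ℝ) (_ : r ∈ Ici (‖z‖ / 2)) => ENNReal.ofReal (h r)) r hr)
  refine (lintegral_mono hpt).trans ?_
  rw [lintegral_mul_const _ (Measurable.ennreal_tsum fun k => (hind k).const_mul _)]
  gcongr
  rw [lintegral_tsum fun k => ((hind k).const_mul _).aemeasurable]
  have hterm : ∀ k : ℕ, (∫⁻ r, volume (ball (0 : Euc d) 1) * ENNReal.ofReal ((2 ^ k * ‖z‖) ^ d) *
        (Ioi (‖z‖ / 4 * 2 ^ k)).indicator (fun _ => 1) r ∂F) ≤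
      ENNReal.ofReal (κ * C * tailF F ‖z‖ * ‖z‖ ^ d * (2 ^ d * q) ^ k) := by
    intro k
    rw [lintegral_const_mul _ (hind k), lintegral_indicator measurableSet_Ioi, setLIntegral_const,
      one_mul, hκe, ← ENNReal.ofReal_toReal (measure_ne_top F (Ioi (‖z‖ / 4 * 2 ^ k))),
      ← ENNReal.ofReal_mul hκ0.le, ← ENNReal.ofReal_mul (by positivity)]
    apply ENNReal.ofReal_le_ofReal
    calc κ * (2 ^ k * ‖z‖) ^ d * (F (Ioi (‖z‖ / 4 * 2 ^ k))).toReal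
        ≤ κ * (2 ^ k * ‖z‖) ^ d * (C * q ^ k * tailF F ‖z‖) := by
          gcongr
          exact hb _ hz k
      _ = _ := by
          rw [mul_pow, mul_pow, ← pow_mul, ← pow_mul, mul_comm k d]; ring
  refine (ENNReal.tsum_le_tsum hterm).trans ?_
  have hsum := summable_geometric_of_lt_one (r := 2 ^ d * q) (by positivity) hq1
  rw [← ENNReal.ofReal_tsum_of_nonneg (fun k => by positivity) (hsum.mul_left _), tsum_mul_left,
    tsum_geometric_of_lt_one (by positivity) hq1]
  apply le_of_eq
  congr 1
  ring
end
end

section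
/- Fix λ > 0, a Borel probability measure F on [0,∞) with ∫ r^d F(dr) < ∞ that follows a power law with tail exponent α > d, and a probability kernel G = (G_r)_{r≥0} on [0,∞), and let q be the retention covariance function defined by the explicit formulas below. Then there exist constants c > 0 and m > 0 such that 0 ≤ q(|x−z|, r₁, r₂) ≤ c·|z|^d·F̄(|z|) for all x, z ∈ ℝ^d and all r₁, r₂ ≥ 0 satisfying |x| < r₁ + r₂, |x − z| ≥ 2(r₁ + r₂), and |z| > m. -/
open MeasureTheory Filter Set Metric ProbabilityTheory

noncomputable section

/-- `F` follows a power law with tail exponent `α`: `F̄(r) = ℓ(r) r^{-α}` with `ℓ`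
slowly varying. -/
def IsPowerLaw (F : Measure ℝ) (α : ℝ) : Prop :=
  ∃ ℓ : ℝ → ℝ, SlowlyVarying ℓ ∧ ∀ x > 0, tailF F x = ℓ x * x ^ (-α)

/-- Retention probability of a grain with radius `r` and weight `w`. -/
def hret (d : ℕ) (lam : ℝ) (F : Measure ℝ) (G : Kernel ℝ ℝ) (r w : ℝ) : ℝ :=
  Real.exp (-(lam * ∫ s, ballVol d (r + s) * ((G s) (Ici w)).toReal ∂F))

/-- Weight-averaged retention probability of a grain with radius `r`. -/
def havg (d : ℕ) (lam : ℝ) (F : Measure ℝ) (G : Kernel ℝ ℝ) (r : ℝ) : ℝ :=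
  ∫ w, hret d lam F G r w ∂(G r)

/-- Pair retention probability of grains with radii `r₁, r₂`, weights `w₁, w₂` and
centers at distance `u` apart. -/
def h2ret (d : ℕ) (lam : ℝ) (F : Measure ℝ) (G : Kernel ℝ ℝ)
    (u r₁ w₁ r₂ w₂ : ℝ) : ℝ :=
  if u ≤ r₁ + r₂ then 0
  else
    hret d lam F G r₁ w₁ * hret d lam F G r₂ w₂ *
      Real.exp (lam * ∫ r, interVol d 0 (r + r₁) (u • e1 d) (r + r₂) *
        ((G r) (Ici (max w₁ w₂))).toReal ∂F)

/-- Weight-averaged pair retention probability. -/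
def h2avg (d : ℕ) (lam : ℝ) (F : Measure ℝ) (G : Kernel ℝ ℝ) (u r₁ r₂ : ℝ) : ℝ :=
  ∫ w₁, ∫ w₂, h2ret d lam F G u r₁ w₁ r₂ w₂ ∂(G r₂) ∂(G r₁)

/-- Retention covariance function `q(u,r₁,r₂) = h₂(u,r₁,r₂) - h(r₁) h(r₂)`. -/
def qret (d : ℕ) (lam : ℝ) (F : Measure ℝ) (G : Kernel ℝ ℝ) (u r₁ r₂ : ℝ) : ℝ :=
  h2avg d lam F G u r₁ r₂ - havg d lam F G r₁ * havg d lam F G r₂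

lemma tailF_ratio (F : Measure ℝ) (α : ℝ) (hpow : IsPowerLaw F α) (a : ℝ) (ha : 0 < a) :
    Tendsto (fun t => tailF F (a * t) / tailF F t) atTop (nhds (a ^ (-α))) := by
  obtain ⟨l, ⟨_, hpos, hl⟩, h⟩ := hpow
  have h1 := (hl a ha).mul_const (a ^ (-α))
  rw [one_mul] at h1
  refine h1.congr' ?_
  filter_upwards [eventually_gt_atTop 0] with t ht
  rw [h t ht, h (a * t) (by positivity), Real.mul_rpow ha.le ht.le]
  have h2 : l t ≠ 0 := (hpos t ht).ne'
  have h3 : t ^ (-α) ≠ 0 := (Real.rpow_pos_of_pos ht _).ne'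
  field_simp

lemma tailF_pos_s9 (F : Measure ℝ) (α : ℝ) (hpow : IsPowerLaw F α) (t : ℝ) (ht : 0 < t) :
    0 < tailF F t := by
  obtain ⟨l, ⟨_, hpos, hl⟩, h⟩ := hpow
  rw [h t ht]
  exact mul_pos (hpos t ht) (Real.rpow_pos_of_pos ht _)

lemma moment_tail (d : ℕ) (F : Measure ℝ) [IsProbabilityMeasure F]
    (hmom : Integrable (fun r : ℝ => r ^ d) F)
    (α : ℝ) (hα : (d : ℝ) < α) (hpow : IsPowerLaw F α) :
    ∃ C > 0, ∃ T > 0, ∀ t, T ≤ t → ∫ r in Ioi t, r ^ d ∂F ≤ C * (t ^ d * tailF F t) := by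
  obtain ⟨ρ, hρ1, hρ2⟩ : ∃ ρ : ℝ, (2:ℝ) ^ (-α) < ρ ∧ ρ < (2:ℝ) ^ (-(d:ℝ)) :=
    exists_between (Real.rpow_lt_rpow_of_exponent_lt (by norm_num) (by linarith))
  have hρ0 : 0 < ρ := lt_trans (by positivity) hρ1
  have hρd : ρ * 2 ^ d < 1 := by
    rw [Real.rpow_neg (by norm_num), Real.rpow_natCast] at hρ2
    rwa [← lt_div_iff₀ (by positivity), one_div]
  obtain ⟨T, hT⟩ := eventually_atTop.1 ((tailF_ratio F α hpow 2 (by norm_num)).eventually_lt_const hρ1)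
  set C : ℝ := 2 ^ d / (1 - ρ * 2 ^ d) with hC
  have hC0 : 0 < C := div_pos (by positivity) (by linarith)
  have hCeq : 2 ^ d + C * (ρ * 2 ^ d) = C := by
    have h1 : C * (1 - ρ * 2 ^ d) = 2 ^ d := div_mul_cancel₀ _ (by linarith)
    linarith
  refine ⟨C, hC0, max T 1, by positivity, ?_⟩
  have key : ∀ n : ℕ, ∀ t, max T 1 ≤ t → ∫ r in Ioi t, r ^ d ∂F ≤
      C * (t ^ d * tailF F t) + ∫ r in Ioi ((2:ℝ) ^ n * t), r ^ d ∂F := by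
    intro n
    induction n with
    | zero =>
      intro t ht
      have : 0 < t := lt_of_lt_of_le one_pos ((le_max_right _ _).trans ht)
      have := tailF_pos_s9 F α hpow t this
      simp only [pow_zero, one_mul]
      have : 0 ≤ C * (t ^ d * tailF F t) := by positivity
      linarith
    | succ n ih =>
      intro t ht
      have ht0 : 0 < t := lt_of_lt_of_le one_pos ((le_max_right _ _).trans ht)
      have htp := tailF_pos_s9 F α hpow t ht0
      have h1 := ih (2 * t) (by linarith)
      rw [show (2:ℝ) ^ n * (2 * t) = 2 ^ (n + 1) * t by ring] at h1
      have h2 : tailF F (2 * t) ≤ ρ * tailF F t := by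
        have := hT t ((le_max_left _ _).trans ht)
        rw [div_lt_iff₀ htp] at this
        exact this.le
      have h3 : ∫ r in Ioi t, r ^ d ∂F = ∫ r in Ioc t (2 * t), r ^ d ∂F
          + ∫ r in Ioi (2 * t), r ^ d ∂F := by
        rw [← setIntegral_union (Ioc_disjoint_Ioi le_rfl) measurableSet_Ioi
          hmom.integrableOn hmom.integrableOn, Ioc_union_Ioi_eq_Ioi (by linarith)]
      have h4 : ∫ r in Ioc t (2 * t), r ^ d ∂F ≤ (2 * t) ^ d * tailF F t := by
        calc ∫ r in Ioc t (2 * t), r ^ d ∂F ≤ ∫ r in Ioc t (2 * t), (2 * t) ^ d ∂F := by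
              refine setIntegral_mono_on hmom.integrableOn (integrable_const _).integrableOn
                measurableSet_Ioc ?_
              intro r hr
              exact pow_le_pow_left₀ (ht0.le.trans hr.1.le) hr.2 d
          _ = F.real (Ioc t (2 * t)) * (2 * t) ^ d := by simp
          _ ≤ tailF F t * (2 * t) ^ d := by
              gcongr
              exact measureReal_mono Ioc_subset_Ioi_self
          _ = _ := mul_comm _ _
      have h5 : C * ((2 * t) ^ d * tailF F (2 * t)) ≤ C * ((2 * t) ^ d * (ρ * tailF F t)) := by
        gcongr
      have h6 : (2 * t) ^ d * tailF F t + C * ((2 * t) ^ d * (ρ * tailF F t))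
          = C * (t ^ d * tailF F t) := by
        calc _ = (2 ^ d + C * (ρ * 2 ^ d)) * (t ^ d * tailF F t) := by rw [mul_pow]; ring
          _ = _ := by rw [hCeq]
      linarith
  intro t ht
  have ht0 : 0 < t := lt_of_lt_of_le one_pos ((le_max_right _ _).trans ht)
  have hlim : Tendsto (fun n : ℕ => ∫ r in Ioi ((2:ℝ) ^ n * t), r ^ d ∂F) atTop (nhds 0) := by
    have h := tendsto_setIntegral_of_antitone (μ := F) (f := fun r : ℝ => r ^ d)
      (s := fun n : ℕ => Ioi ((2:ℝ) ^ n * t)) (fun n => measurableSet_Ioi)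
      (by
        intro m n hmn
        apply Ioi_subset_Ioi
        have : (2:ℝ) ^ m ≤ 2 ^ n := pow_le_pow_right₀ (by norm_num) hmn
        gcongr) ⟨0, hmom.integrableOn⟩
    have he : (⋂ n : ℕ, Ioi ((2:ℝ) ^ n * t)) = ∅ := by
      ext r
      simp only [mem_iInter, mem_Ioi, mem_empty_iff_false, iff_false, not_forall, not_lt]
      have h2 : Tendsto (fun n : ℕ => (2:ℝ) ^ n * t) atTop atTop :=
        (tendsto_pow_atTop_atTop_of_one_lt (by norm_num)).atTop_mul_const ht0
      exact (h2.eventually_ge_atTop r).exists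
    rw [he] at h
    simpa using h
  have := ge_of_tendsto' (hlim.const_add (C * (t ^ d * tailF F t))) (fun n => key n t ht)
  simpa using this

lemma ballVol_eq (d : ℕ) (r : ℝ) (hr : 0 ≤ r) : ballVol d r = r ^ d * ballVol d 1 := by
  unfold ballVol
  rw [Measure.addHaar_closedBall' _ _ hr, Measure.addHaar_closedBall' _ _ zero_le_one]
  simp [ENNReal.toReal_mul, ENNReal.toReal_ofReal, hr]

lemma ballVol_nonneg (d : ℕ) (r : ℝ) : 0 ≤ ballVol d r := ENNReal.toReal_nonneg

lemma ballVol_mono (d : ℕ) : Monotone (ballVol d) := fun _ _ h =>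
  ENNReal.toReal_mono measure_closedBall_lt_top.ne (measure_mono (closedBall_subset_closedBall h))

lemma interVol_nonneg (d : ℕ) (x : Euc d) (r : ℝ) (y : Euc d) (s : ℝ) :
    0 ≤ interVol d x r y s := ENNReal.toReal_nonneg

lemma interVol_le (d : ℕ) (r : ℝ) (y : Euc d) (s : ℝ) :
    interVol d 0 r y s ≤ ballVol d r :=
  ENNReal.toReal_mono measure_closedBall_lt_top.ne (measure_mono inter_subset_left)

lemma interVol_mono (d : ℕ) (x y : Euc d) (a b : ℝ) :
    Monotone (fun r => interVol d x (r + a) y (r + b)) := by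
  intro r s h
  refine ENNReal.toReal_mono ?_ (measure_mono (inter_subset_inter
    (closedBall_subset_closedBall (by linarith)) (closedBall_subset_closedBall (by linarith))))
  exact ((measure_mono inter_subset_left).trans_lt measure_closedBall_lt_top).ne

lemma interVol_eq_zero (d : ℕ) (hd : 0 < d) (u r s : ℝ) (hu : 0 ≤ u) (h : r + s < u) :
    interVol d 0 r (u • e1 d) s = 0 := by
  unfold interVol
  have he : closedBall (0 : Euc d) r ∩ closedBall (u • e1 d) s = ∅ := by
    ext p
    simp only [mem_inter_iff, mem_closedBall, mem_empty_iff_false, iff_false, not_and, not_le]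
    intro h1
    have h2 : dist (0 : Euc d) (u • e1 d) = u := by
      rw [dist_zero_left, norm_smul]
      simp [e1, hd, abs_of_nonneg hu]
    have h3 := dist_triangle_left (0 : Euc d) (u • e1 d) p
    linarith
  rw [he]; simp

lemma G_nonneg (G : Kernel ℝ ℝ) (s w : ℝ) : 0 ≤ ((G s) (Ici w)).toReal := ENNReal.toReal_nonneg

lemma G_le_one (G : Kernel ℝ ℝ) [IsMarkovKernel G] (s w : ℝ) : ((G s) (Ici w)).toReal ≤ 1 :=
  measureReal_le_one (μ := G s)

lemma G_anti (G : Kernel ℝ ℝ) [IsMarkovKernel G] (s : ℝ) :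
    Antitone (fun w => ((G s) (Ici w)).toReal) := fun _ _ h =>
  ENNReal.toReal_mono (measure_ne_top _ _) (measure_mono (Ici_subset_Ici.2 h))

lemma G_meas (G : Kernel ℝ ℝ) (w : ℝ) : Measurable (fun s => ((G s) (Ici w)).toReal) :=
  (G.measurable_coe measurableSet_Ici).ennreal_toReal

lemma ballVol_integrable (d : ℕ) (F : Measure ℝ) [IsProbabilityMeasure F] (hsupp : F (Iio 0) = 0)
    (hmom : Integrable (fun r : ℝ => r ^ d) F) (r : ℝ) (hr : 0 ≤ r) :
    Integrable (fun s => ballVol d (r + s)) F := by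
  have hm : Measurable (fun s => ballVol d (r + s)) :=
    (ballVol_mono d).measurable.comp (measurable_const.add measurable_id)
  have hi : Integrable (fun s : ℝ => (2 ^ d * (r ^ d + s ^ d)) * ballVol d 1) F :=
    (((integrable_const _).add hmom).const_mul _).mul_const _
  refine hi.mono' hm.aestronglyMeasurable ?_
  have hae : ∀ᵐ s ∂F, 0 ≤ s := by
    rw [ae_iff]; simpa [Iio] using hsupp
  filter_upwards [hae] with s hs
  rw [Real.norm_of_nonneg (ballVol_nonneg _ _), ballVol_eq d _ (by positivity)]
  gcongr
  · exact ballVol_nonneg _ _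
  · have h1 : (r + s) ^ d ≤ (2 * max r s) ^ d := by
      gcongr
      linarith [le_max_left r s, le_max_right r s]
    refine h1.trans ?_
    rw [mul_pow]
    gcongr
    rcases max_choice r s with h | h <;> rw [h]
    · linarith [pow_nonneg hs d]
    · linarith [pow_nonneg hr d]

lemma mul_G_integrable (F : Measure ℝ) (G : Kernel ℝ ℝ) [IsMarkovKernel G]
    (f : ℝ → ℝ) (hf : Integrable f F) (w : ℝ) :
    Integrable (fun s => f s * ((G s) (Ici w)).toReal) F := by
  refine hf.mul_bdd (c := 1) (G_meas G w).aestronglyMeasurable (ae_of_all _ fun s => ?_)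
  rw [Real.norm_of_nonneg (G_nonneg _ _ _)]
  exact G_le_one _ _ _

lemma integral_G_anti (F : Measure ℝ) (G : Kernel ℝ ℝ) [IsMarkovKernel G]
    (f : ℝ → ℝ) (hf : Integrable f F) (hf0 : ∀ s, 0 ≤ f s) :
    Antitone (fun w => ∫ s, f s * ((G s) (Ici w)).toReal ∂F) := fun a b hab =>
  integral_mono (mul_G_integrable F G f hf b) (mul_G_integrable F G f hf a)
    fun s => mul_le_mul_of_nonneg_left (G_anti G s hab) (hf0 s)

/-- Uniform bound of the retention covariance on the region where the two reference
grains are distant and the integration variable is close to the origin. -/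
theorem stmt9 (d : ℕ) (hd : 0 < d) (lam : ℝ) (hlam : 0 < lam)
    (F : Measure ℝ) [IsProbabilityMeasure F] (hsupp : F (Iio 0) = 0)
    (hmom : Integrable (fun r : ℝ => r ^ d) F)
    (α : ℝ) (hα : (d : ℝ) < α) (hpow : IsPowerLaw F α)
    (G : Kernel ℝ ℝ) [IsMarkovKernel G] :
    ∃ c > 0, ∃ m > 0, ∀ (x z : Euc d) (r₁ r₂ : ℝ), 0 ≤ r₁ → 0 ≤ r₂ →
      ‖x‖ < r₁ + r₂ → 2 * (r₁ + r₂) ≤ ‖x - z‖ → m < ‖z‖ →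
      0 ≤ qret d lam F G ‖x - z‖ r₁ r₂ ∧
        qret d lam F G ‖x - z‖ r₁ r₂ ≤ c * ‖z‖ ^ d * tailF F ‖z‖ := by
  obtain ⟨C, hC, T, hT, hmt⟩ := moment_tail d F hmom α hα hpow
  set C2 : ℝ := (1 / 8 : ℝ) ^ (-α) + 1 with hC2
  have hC2p : 0 < C2 := by positivity
  obtain ⟨M, hM⟩ := eventually_atTop.1
    ((tailF_ratio F α hpow (1 / 8) (by norm_num)).eventually_lt_const
      (show _ < C2 by rw [hC2]; linarith))
  set κ := ballVol d 1 with hκ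
  have hκ0 : 0 ≤ κ := ballVol_nonneg _ _
  refine ⟨lam * (κ * 9 ^ d * C * C2) + 1, by positivity, max (8 * T) M, by positivity, ?_⟩
  intro x z r₁ r₂ hr₁ hr₂ hx hu hz
  have hz8 : 8 * T < ‖z‖ := (le_max_left _ _).trans_lt hz
  have hzM : M ≤ ‖z‖ := ((le_max_right _ _).trans_lt hz).le
  have hz0 : 0 < ‖z‖ := by linarith
  have hxn : 0 ≤ ‖x‖ := norm_nonneg x
  have hu1 : ‖x - z‖ ≤ ‖x‖ + ‖z‖ := norm_sub_le x z
  have hu2 : ‖z‖ ≤ ‖x‖ + ‖x - z‖ := by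
    have := norm_sub_le x (x - z)
    simpa using this
  generalize ‖x - z‖ = u at *
  have hu0 : 0 < u := by linarith
  have hae : ∀ᵐ s ∂F, 0 ≤ s := by
    rw [ae_iff]; simpa [Iio] using hsupp
  have htz := tailF_pos_s9 F α hpow _ hz0
  -- the interaction integral
  let f : ℝ → ℝ := fun r => interVol d 0 (r + r₁) (u • e1 d) (r + r₂)
  have hf0 : ∀ s, 0 ≤ f s := fun s => interVol_nonneg _ _ _ _ _
  have hb1 := ballVol_integrable d F hsupp hmom r₁ hr₁
  have hb2 := ballVol_integrable d F hsupp hmom r₂ hr₂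
  have hfb : ∀ s, f s ≤ ballVol d (r₁ + s) := fun s => by
    rw [add_comm r₁ s]; exact interVol_le _ _ _ _
  have hf : Integrable f F := by
    refine hb1.mono' (interVol_mono d _ _ r₁ r₂).measurable.aestronglyMeasurable
      (ae_of_all _ fun s => ?_)
    rw [Real.norm_of_nonneg (hf0 s)]
    exact hfb s
  let I : ℝ → ℝ := fun w => ∫ s, f s * ((G s) (Ici w)).toReal ∂F
  have hIanti : Antitone I := integral_G_anti F G f hf hf0
  have hI0 : ∀ w, 0 ≤ I w := fun w =>
    integral_nonneg fun s => mul_nonneg (hf0 s) (G_nonneg _ _ _)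
  have hIK : ∀ w, I w ≤ κ * 9 ^ d * C * C2 * (‖z‖ ^ d * tailF F ‖z‖) := by
    intro w
    have h1 : I w ≤ ∫ r, (Ioi (‖z‖ / 8)).indicator (fun r => κ * 9 ^ d * r ^ d) r ∂F := by
      refine integral_mono_ae (mul_G_integrable F G f hf w)
        ((hmom.const_mul _).indicator measurableSet_Ioi) ?_
      filter_upwards [hae] with r hr
      have h2 : f r * ((G r) (Ici w)).toReal ≤ f r :=
        mul_le_of_le_one_right (hf0 r) (G_le_one _ _ _)
      refine h2.trans ?_
      by_cases hrz : r ∈ Ioi (‖z‖ / 8)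
      · rw [indicator_of_mem hrz]
        have hrz' : ‖z‖ / 8 < r := hrz
        refine (hfb r).trans ?_
        refine (ballVol_mono d (show r₁ + r ≤ 9 * r by linarith)).trans ?_
        rw [ballVol_eq d _ (by positivity), mul_pow]
        apply le_of_eq; ring
      · rw [indicator_of_notMem hrz]
        have hrz' : r ≤ ‖z‖ / 8 := not_lt.1 hrz
        exact (interVol_eq_zero d hd u _ _ hu0.le (by linarith)).le
    rw [integral_indicator measurableSet_Ioi, integral_const_mul] at h1
    have h2 := hmt (‖z‖ / 8) (by linarith)
    have h3 : tailF F (‖z‖ / 8) ≤ C2 * tailF F ‖z‖ := by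
      have := hM ‖z‖ hzM
      rw [div_lt_iff₀ htz, show (1 / 8 : ℝ) * ‖z‖ = ‖z‖ / 8 by ring] at this
      exact this.le
    have h4 : (‖z‖ / 8) ^ d ≤ ‖z‖ ^ d := by
      gcongr
      linarith
    have h5 : (‖z‖ / 8) ^ d * tailF F (‖z‖ / 8) ≤ ‖z‖ ^ d * (C2 * tailF F ‖z‖) :=
      mul_le_mul h4 h3 ENNReal.toReal_nonneg (by positivity)
    calc I w ≤ κ * 9 ^ d * ∫ r in Ioi (‖z‖ / 8), r ^ d ∂F := h1
      _ ≤ κ * 9 ^ d * (C * (‖z‖ ^ d * (C2 * tailF F ‖z‖))) := by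
          gcongr
          exact h2.trans (by gcongr)
      _ = _ := by ring
  -- retention probabilities
  have hpos : ∀ r w, 0 ≤ hret d lam F G r w := fun r w => (Real.exp_pos _).le
  have hle1 : ∀ r w, hret d lam F G r w ≤ 1 := fun r w => by
    refine Real.exp_le_one_iff.2 (neg_nonpos.2 (mul_nonneg hlam.le ?_))
    exact integral_nonneg fun s => mul_nonneg (ballVol_nonneg _ _) (G_nonneg _ _ _)
  have hmeas : ∀ r, 0 ≤ r → Measurable (hret d lam F G r) := fun r hr => by
    have h := (integral_G_anti F G _ (ballVol_integrable d F hsupp hmom r hr)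
      (fun s => ballVol_nonneg _ _)).measurable
    exact Real.measurable_exp.comp (h.const_mul lam).neg
  have hexp : ∀ w₁ w₂, hret d lam F G r₁ w₁ * Real.exp (lam * I (max w₁ w₂)) ≤ 1 := by
    intro w₁ w₂
    unfold hret
    rw [← Real.exp_add]
    refine Real.exp_le_one_iff.2 ?_
    have h1 : I (max w₁ w₂) ≤ ∫ s, ballVol d (r₁ + s) * ((G s) (Ici w₁)).toReal ∂F := by
      refine (hIanti (le_max_left w₁ w₂)).trans ?_
      exact integral_mono (mul_G_integrable F G f hf _) (mul_G_integrable F G _ hb1 _)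
        fun s => mul_le_mul_of_nonneg_right (hfb s) (G_nonneg _ _ _)
    have := mul_le_mul_of_nonneg_left h1 hlam.le
    linarith
  have hh2 : ∀ w₁ w₂, h2ret d lam F G u r₁ w₁ r₂ w₂ =
      hret d lam F G r₁ w₁ * hret d lam F G r₂ w₂ * Real.exp (lam * I (max w₁ w₂)) := by
    intro w₁ w₂
    unfold h2ret
    rw [if_neg (by linarith)]
  let P : Measure (ℝ × ℝ) := (G r₁).prod (G r₂)
  have hm1 : Measurable (fun p : ℝ × ℝ => hret d lam F G r₁ p.1 * hret d lam F G r₂ p.2) :=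
    ((hmeas r₁ hr₁).comp measurable_fst).mul ((hmeas r₂ hr₂).comp measurable_snd)
  have hm2 : Measurable (fun p : ℝ × ℝ => h2ret d lam F G u r₁ p.1 r₂ p.2) := by
    simp only [hh2]
    refine hm1.mul (Real.measurable_exp.comp (Measurable.const_mul ?_ lam))
    exact hIanti.measurable.comp (measurable_fst.max measurable_snd)
  have hi1 : Integrable (fun p : ℝ × ℝ => hret d lam F G r₁ p.1 * hret d lam F G r₂ p.2) P := by
    refine Integrable.of_bound hm1.aestronglyMeasurable 1 (ae_of_all _ fun p => ?_)
    rw [Real.norm_of_nonneg (mul_nonneg (hpos _ _) (hpos _ _))]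
    exact mul_le_one₀ (hle1 _ _) (hpos _ _) (hle1 _ _)
  have hi2 : Integrable (fun p : ℝ × ℝ => h2ret d lam F G u r₁ p.1 r₂ p.2) P := by
    refine Integrable.of_bound hm2.aestronglyMeasurable 1 (ae_of_all _ fun p => ?_)
    rw [hh2, Real.norm_of_nonneg (mul_nonneg (mul_nonneg (hpos _ _) (hpos _ _))
      (Real.exp_pos _).le), mul_right_comm]
    exact mul_le_one₀ (hexp _ _) (hpos _ _) (hle1 _ _)
  have hq : qret d lam F G u r₁ r₂ = ∫ p, (h2ret d lam F G u r₁ p.1 r₂ p.2 -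
      hret d lam F G r₁ p.1 * hret d lam F G r₂ p.2) ∂P := by
    rw [integral_sub hi2 hi1, integral_prod _ hi2, integral_prod_mul]
    rfl
  rw [hq]
  constructor
  · refine integral_nonneg fun p => ?_
    change 0 ≤ h2ret d lam F G u r₁ p.1 r₂ p.2 - hret d lam F G r₁ p.1 * hret d lam F G r₂ p.2
    rw [hh2, sub_nonneg]
    refine le_mul_of_one_le_right (mul_nonneg (hpos _ _) (hpos _ _)) ?_
    exact Real.one_le_exp (mul_nonneg hlam.le (hI0 _))
  · have hbd : ∀ p : ℝ × ℝ, h2ret d lam F G u r₁ p.1 r₂ p.2 -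
        hret d lam F G r₁ p.1 * hret d lam F G r₂ p.2 ≤
        lam * (κ * 9 ^ d * C * C2 * (‖z‖ ^ d * tailF F ‖z‖)) := by
      intro p
      rw [hh2]
      have hy0 : 0 ≤ lam * I (max p.1 p.2) := mul_nonneg hlam.le (hI0 _)
      have hyK := mul_le_mul_of_nonneg_left (hIK (max p.1 p.2)) hlam.le
      have he := hexp p.1 p.2
      have ha := hpos r₁ p.1
      have hb := hpos r₂ p.2
      have hb1' := hle1 r₂ p.2
      refine le_trans ?_ hyK
      generalize lam * I (max p.1 p.2) = y at *
      generalize hret d lam F G r₁ p.1 = a at *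
      generalize hret d lam F G r₂ p.2 = b at *
      have h1 : Real.exp y - 1 ≤ y * Real.exp y := by
        have h2 := Real.add_one_le_exp (-y)
        have h3 := mul_le_mul_of_nonneg_right h2 (Real.exp_pos y).le
        rw [← Real.exp_add, neg_add_cancel, Real.exp_zero] at h3
        linarith
      calc a * b * Real.exp y - a * b = (a * b) * (Real.exp y - 1) := by ring
        _ ≤ (a * b) * (y * Real.exp y) := by gcongr
        _ = y * (b * (a * Real.exp y)) := by ring
        _ ≤ y * 1 := by
            gcongr
            exact mul_le_one₀ hb1' (by positivity) he
        _ = y := mul_one y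
    have hZ : 0 ≤ ‖z‖ ^ d * tailF F ‖z‖ := by positivity
    calc _ ≤ ∫ p, lam * (κ * 9 ^ d * C * C2 * (‖z‖ ^ d * tailF F ‖z‖)) ∂P :=
          integral_mono (hi2.sub hi1) (integrable_const _) hbd
      _ = lam * (κ * 9 ^ d * C * C2 * (‖z‖ ^ d * tailF F ‖z‖)) := by simp [P]
      _ ≤ (lam * (κ * 9 ^ d * C * C2) + 1) * ‖z‖ ^ d * tailF F ‖z‖ := by linarith
end
end
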